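/- Sparse domination of the set-valued maximal operator: let D be a dyadic grid in R^d and F ⊆ D a finite collection of cubes. For every locally integrably bounded convex-set valued mapping G: R^d → (nonempty closed convex symmetric subsets of F^n), there is a sparse subcollection S ⊆ F such that M^K_F G(x) ⊆ 2n^{5/2} M^K_S G(x) for a.e. x. -/

import Mathlib

open MeasureTheory ENNReal Pointwise

variable {𝕜 : Type*} [RCLike 𝕜] {n : ℕ}
  [MeasurableSpace (EuclideanSpace 𝕜 (Fin n))] [BorelSpace (EuclideanSpace 𝕜 (Fin n))]

/-- A subset of an `𝕜`-vector space is *symmetric* if it is closed under multiplication by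
unimodular scalars. -/
def SymmSet (𝕜 : Type*) [RCLike 𝕜] {E : Type*} [SMul 𝕜 E] (K : Set E) : Prop :=
  ∀ c : 𝕜, ‖c‖ = 1 → ∀ x ∈ K, c • x ∈ K

/-- The smallest closed convex symmetric subset of `𝔽ⁿ` containing a given set. -/
def convK (𝕜 : Type*) [RCLike 𝕜] {n : ℕ} (S : Set (EuclideanSpace 𝕜 (Fin n))) :
    Set (EuclideanSpace 𝕜 (Fin n)) :=
  ⋂₀ {K | IsClosed K ∧ Convex ℝ K ∧ SymmSet 𝕜 K ∧ S ⊆ K}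

/-- A measurable set-valued map with nonempty closed convex symmetric values. -/
def GoodSetValued (𝕜 : Type*) [RCLike 𝕜] {n : ℕ} {Ω : Type*} [MeasurableSpace Ω]
    [MeasurableSpace (EuclideanSpace 𝕜 (Fin n))]
    (F : Ω → Set (EuclideanSpace 𝕜 (Fin n))) : Prop :=
  (∀ x, (F x).Nonempty ∧ IsClosed (F x) ∧ Convex ℝ (F x) ∧ SymmSet 𝕜 (F x)) ∧
  ∀ E : Set (EuclideanSpace 𝕜 (Fin n)), MeasurableSet E →
    MeasurableSet {x | (F x ∩ E).Nonempty}

/-- An axis-parallel cube in `ℝᵈ`. -/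
def IsCube (d : ℕ) (Q : Set (Fin d → ℝ)) : Prop :=
  ∃ (a : Fin d → ℝ) (r : ℝ), 0 < r ∧ Q = Set.univ.pi fun i => Set.Icc (a i) (a i + r)

/-- The translated dyadic grid in `ℝᵈ` with translation parameter `α`. -/
def dyadicGrid (d : ℕ) (α : Fin d → ℝ) : Set (Set (Fin d → ℝ)) :=
  {Q | ∃ (k : ℤ) (m : Fin d → ℤ), Q = Set.univ.pi fun i =>
    Set.Ico (α i + (2 : ℝ) ^ k * m i) (α i + (2 : ℝ) ^ k * (m i + 1))}

/-- A collection `S` of cubes is *sparse* if for every `Q ∈ S` the union of the cubes of `S`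
strictly contained in `Q` has measure at most `|Q|/2`. -/
def IsSparse (d : ℕ) (S : Set (Set (Fin d → ℝ))) : Prop :=
  ∀ Q ∈ S, volume (⋃ Q' ∈ {Q' ∈ S | Q' ⊂ Q}, Q') ≤ volume Q / 2

/-- The Aumann average `⟨G⟩_Q`: averages of integrable measurable selections of `G·1_Q`. -/
def avgSet (d : ℕ) (G : (Fin d → ℝ) → Set (EuclideanSpace 𝕜 (Fin n)))
    (Q : Set (Fin d → ℝ)) : Set (EuclideanSpace 𝕜 (Fin n)) :=
  {v | ∃ g : (Fin d → ℝ) → EuclideanSpace 𝕜 (Fin n), Measurable g ∧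
    (∀ᵐ x, x ∈ Q → g x ∈ G x) ∧ IntegrableOn g Q volume ∧ v = ⨍ x in Q, g x}

/-- The convex-set valued maximal operator associated to a collection of cubes `P`:
`M^𝒦_P G (x)` is the smallest closed convex symmetric set containing
`⋃_{Q ∈ P} ⟨G⟩_Q 1_Q(x)`. -/
def maximalK (d : ℕ) (P : Set (Set (Fin d → ℝ)))
    (G : (Fin d → ℝ) → Set (EuclideanSpace 𝕜 (Fin n))) (x : Fin d → ℝ) :
    Set (EuclideanSpace 𝕜 (Fin n)) :=
  convK 𝕜 ({0} ∪ ⋃ Q ∈ {Q ∈ P | x ∈ Q}, avgSet d G Q)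

theorem auerbach_exists {E : Type*} [NormedAddCommGroup E] [NormedSpace 𝕜 E]
    [FiniteDimensional 𝕜 E] (K : Set E) (hK : IsCompact K) :
    ∃ (m : ℕ) (v : Fin m → E) (f : Fin m → E →ₗ[𝕜] 𝕜), m ≤ Module.finrank 𝕜 E ∧
      (∀ i, v i ∈ K) ∧ (∀ i, ∀ w ∈ K, ‖f i w‖ ≤ 1) ∧
      ∀ w ∈ Submodule.span 𝕜 K, w = ∑ i, f i w • v i := by
  classical
  let W := Submodule.span 𝕜 K
  obtain ⟨u, huK, huspan, huli⟩ : ∃ f : Fin (Module.finrank 𝕜 W) → E, (∀ i, f i ∈ K) ∧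
      Submodule.span 𝕜 (Set.range f) = W ∧ LinearIndependent 𝕜 f :=
    Submodule.exists_fun_fin_finrank_span_eq 𝕜 K
  let K' : Set W := Subtype.val ⁻¹' K
  have hK' : IsCompact K' := by
    have hc : IsClosed (W : Set E) := W.closed_of_finiteDimensional
    exact (hc.isClosedEmbedding_subtypeVal).isCompact_preimage hK
  let b := Module.finBasis 𝕜 W
  let u' : Fin (Module.finrank 𝕜 W) → W := fun i => ⟨u i, Submodule.subset_span (huK i)⟩
  have hu'li : LinearIndependent 𝕜 u' := by
    apply LinearIndependent.of_comp W.subtype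
    exact huli
  have hu'det : b.det u' ≠ 0 := by
    have : IsUnit (b.det u') := by
      rw [← Module.Basis.is_basis_iff_det]
      exact ⟨hu'li, hu'li.span_eq_top_of_card_eq_finrank' (by simp)⟩
    exact this.ne_zero
  have hcont : Continuous (fun v : Fin (Module.finrank 𝕜 W) → W => ‖b.det v‖) := by
    apply Continuous.norm
    change Continuous (fun v : Fin (Module.finrank 𝕜 W) → W => (b.toMatrix v).det)
    apply Continuous.matrix_det
    refine continuous_matrix fun i j => ?_
    simp only [Module.Basis.toMatrix_apply]
    exact (LinearMap.continuous_of_finiteDimensional (b.coord i)).comp (continuous_apply j)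
  have hcomp : IsCompact (Set.univ.pi fun _ : Fin (Module.finrank 𝕜 W) => K') :=
    isCompact_univ_pi fun _ => hK'
  obtain ⟨v, hv, hmax⟩ := hcomp.exists_isMaxOn ⟨u', fun i _ => huK i⟩ hcont.continuousOn
  have hvdet : b.det v ≠ 0 := by
    have h1 := hmax (show u' ∈ _ from fun i _ => huK i)
    have h2 : 0 < ‖b.det u'‖ := norm_pos_iff.2 hu'det
    exact norm_pos_iff.1 (lt_of_lt_of_le h2 h1)
  obtain ⟨hli, hsp⟩ := (Module.Basis.is_basis_iff_det b).2 (isUnit_iff_ne_zero.2 hvdet)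
  let B := Module.Basis.mk hli hsp.ge
  have hcoord : ∀ i, ∀ w : W, w ∈ K' → ‖B.coord i w‖ ≤ 1 := by
    intro i w hw
    have h1 := congrArg (fun l => l w) (b.det_smul_mk_coord_eq_det_update hli hsp.ge i)
    have h1' : b.det v * B.coord i w = b.det (Function.update v i w) := h1
    have h2 : ‖b.det (Function.update v i w)‖ ≤ ‖b.det v‖ := by
      apply hmax
      intro j _
      by_cases hj : j = i
      · subst hj; simpa using hw
      · simpa [hj] using hv j (Set.mem_univ j)
    rw [← h1', norm_mul] at h2
    have h3 : 0 < ‖b.det v‖ := norm_pos_iff.2 hvdet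
    nlinarith
  have hext : ∀ i, ∃ f : E →ₗ[𝕜] 𝕜, f.comp W.subtype = B.coord i :=
    fun i => LinearMap.exists_extend (B.coord i)
  choose f hf using hext
  have hf' : ∀ i (w : W), f i w = B.coord i w := fun i w => congrArg (fun l => l w) (hf i)
  refine ⟨_, fun i => (v i : E), f, Submodule.finrank_le W, fun i => hv i (Set.mem_univ i), ?_, ?_⟩
  · intro i w hw
    have := hcoord i ⟨w, Submodule.subset_span hw⟩ hw
    rwa [← hf'] at this
  · intro w hw
    have h := B.sum_repr ⟨w, hw⟩
    have h2 := congrArg (Subtype.val) h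
    simp only [Submodule.coe_sum, Submodule.coe_smul] at h2
    rw [← h2]
    have hBv : ∀ i, B i = v i := fun i => by simp [B]
    rw [h2]
    conv_lhs => rw [← h2]
    refine Finset.sum_congr rfl fun i _ => ?_
    rw [hBv]
    congr 1
    exact (hf' i ⟨w, hw⟩).symm

theorem greedy_select {X : Type*} [PartialOrder X] (bad : X → X → Prop) (F : Finset X) :
    ∃ S ⊆ F, (∀ q ∈ F, q ∉ S → ∃ r ∈ S, q < r ∧ ¬ bad q r) ∧
      ∀ q ∈ S, ∀ q' ∈ S, q' < q → bad q' q := by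
  classical
  induction F using Finset.strongInduction with
  | H F ih =>
    rcases F.eq_empty_or_nonempty with rfl | hne
    · exact ⟨∅, by simp⟩
    · obtain ⟨q0, hq0, hmin⟩ := F.exists_minimal hne
      obtain ⟨S, hSF, h1, h2⟩ := ih (F.erase q0) (Finset.erase_ssubset hq0)
      have hSF' : S ⊆ F := hSF.trans (Finset.erase_subset _ _)
      by_cases h : ∃ r ∈ S, q0 < r ∧ ¬ bad q0 r
      · refine ⟨S, hSF', fun q hq hqS => ?_, h2⟩
        by_cases hqq : q = q0
        · subst hqq; exact h
        · exact h1 q (Finset.mem_erase.2 ⟨hqq, hq⟩) hqS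
      · push Not at h
        refine ⟨insert q0 S, Finset.insert_subset hq0 hSF', fun q hq hqS => ?_, ?_⟩
        · rw [Finset.mem_insert, not_or] at hqS
          obtain ⟨r, hr, hr'⟩ := h1 q (Finset.mem_erase.2 ⟨hqS.1, hq⟩) hqS.2
          exact ⟨r, Finset.mem_insert_of_mem hr, hr'⟩
        · intro q hq q' hq' hlt
          rw [Finset.mem_insert] at hq hq'
          rcases hq with rfl | hq
          · exfalso
            rcases hq' with rfl | hq'
            · exact lt_irrefl _ hlt
            · exact absurd (hmin (hSF' hq') hlt.le) (not_le_of_gt hlt)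
          · rcases hq' with rfl | hq'
            · exact h q hq hlt
            · exact h2 q hq q' hq' hlt

theorem grid_facts {d : ℕ} {α : Fin d → ℝ} {Q : Set (Fin d → ℝ)} (hQ : Q ∈ dyadicGrid d α) :
    MeasurableSet Q ∧ volume Q ≠ ⊤ ∧ 0 < volume.real Q ∧ ∃ Q', IsCube d Q' ∧ Q ⊆ Q' := by
  obtain ⟨k, m, rfl⟩ := hQ
  have hk : (0 : ℝ) < 2 ^ k := by positivity
  refine ⟨MeasurableSet.univ_pi fun i => measurableSet_Ico, ?_, ?_, ?_⟩
  · rw [Real.volume_pi_Ico]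
    exact ENNReal.prod_ne_top fun i _ => ENNReal.ofReal_ne_top
  · rw [Measure.real, Real.volume_pi_Ico, ENNReal.toReal_prod]
    refine Finset.prod_pos fun i _ => ?_
    rw [ENNReal.toReal_ofReal] <;> nlinarith
  · refine ⟨_, ⟨fun i => α i + 2 ^ k * m i, 2 ^ k, hk, rfl⟩, ?_⟩
    intro x hx i hi
    have := hx i hi
    refine ⟨this.1, ?_⟩
    have h2 := this.2
    simp only at h2 ⊢
    linarith

theorem grid_aux {d : ℕ} {α : Fin d → ℝ} {k k' : ℤ} (hkk : k ≤ k') (m m' : Fin d → ℤ)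
    (x : Fin d → ℝ)
    (hx : x ∈ Set.univ.pi fun i =>
      Set.Ico (α i + (2 : ℝ) ^ k * m i) (α i + (2 : ℝ) ^ k * (m i + 1)))
    (hx' : x ∈ Set.univ.pi fun i =>
      Set.Ico (α i + (2 : ℝ) ^ k' * m' i) (α i + (2 : ℝ) ^ k' * (m' i + 1))) :
    (Set.univ.pi fun i => Set.Ico (α i + (2 : ℝ) ^ k * m i) (α i + (2 : ℝ) ^ k * (m i + 1))) ⊆
    (Set.univ.pi fun i =>
      Set.Ico (α i + (2 : ℝ) ^ k' * m' i) (α i + (2 : ℝ) ^ k' * (m' i + 1))) := by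
  obtain ⟨N, rfl⟩ := Int.le.dest hkk
  have hk : (0 : ℝ) < 2 ^ k := by positivity
  have hp : (2 : ℝ) ^ (k + (N : ℤ)) = 2 ^ k * ((2 ^ N : ℤ) : ℝ) := by
    rw [zpow_add₀ (by norm_num)]; simp
  intro y hy i hi
  have h1 := hx i hi
  have h2 := hx' i hi
  have h3 := hy i hi
  simp only [Set.mem_Ico, hp] at h1 h2 h3 ⊢
  have e1 : (2 ^ N : ℤ) * m' i < m i + 1 := by
    have : ((2 ^ N : ℤ) : ℝ) * m' i < m i + 1 := by
      apply lt_of_mul_lt_mul_left _ hk.le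
      linarith [h2.1, h1.2]
    exact_mod_cast this
  have e2 : m i < (2 ^ N : ℤ) * (m' i + 1) := by
    have : (m i : ℝ) < ((2 ^ N : ℤ) : ℝ) * (m' i + 1) := by
      apply lt_of_mul_lt_mul_left _ hk.le
      linarith [h2.2, h1.1]
    exact_mod_cast this
  have f1 : ((2 ^ N : ℤ) : ℝ) * m' i ≤ m i := by exact_mod_cast Int.lt_add_one_iff.1 e1
  have f2 : (m i : ℝ) + 1 ≤ ((2 ^ N : ℤ) : ℝ) * (m' i + 1) := by
    exact_mod_cast Int.add_one_le_iff.2 e2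
  have g1 := mul_le_mul_of_nonneg_left f1 hk.le
  have g2 := mul_le_mul_of_nonneg_left f2 hk.le
  constructor <;> linarith [h3.1, h3.2]

theorem grid_laminar {d : ℕ} {α : Fin d → ℝ} {Q Q' : Set (Fin d → ℝ)}
    (hQ : Q ∈ dyadicGrid d α) (hQ' : Q' ∈ dyadicGrid d α) (h : ¬ Disjoint Q Q') :
    Q ⊆ Q' ∨ Q' ⊆ Q := by
  obtain ⟨k, m, rfl⟩ := hQ
  obtain ⟨k', m', rfl⟩ := hQ'
  obtain ⟨x, hx, hx'⟩ := Set.not_disjoint_iff.1 h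
  rcases le_total k k' with hk | hk
  · exact Or.inl (grid_aux hk m m' x hx hx')
  · exact Or.inr (grid_aux hk m' m x hx' hx)

set_option linter.unusedSectionVars false

theorem zero_mem_of_symm {K : Set (EuclideanSpace 𝕜 (Fin n))} (h1 : K.Nonempty)
    (h2 : Convex ℝ K) (h3 : SymmSet 𝕜 K) : (0 : EuclideanSpace 𝕜 (Fin n)) ∈ K := by
  obtain ⟨x, hx⟩ := h1
  have hx' := h3 (-1) (by simp) x hx
  have := h2 hx hx' (show (0 : ℝ) ≤ 1 / 2 by norm_num) (show (0 : ℝ) ≤ 1 / 2 by norm_num)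
    (by norm_num)
  simpa using this

theorem avgSet_symm {d : ℕ} {G : (Fin d → ℝ) → Set (EuclideanSpace 𝕜 (Fin n))}
    (hG : GoodSetValued 𝕜 G) (Q : Set (Fin d → ℝ)) : SymmSet 𝕜 (avgSet d G Q) := by
  rintro c hc _ ⟨g, hg, hsel, hint, rfl⟩
  refine ⟨fun x => c • g x, hg.const_smul c, ?_, hint.smul c, ?_⟩
  · filter_upwards [hsel] with x hx hxQ
    exact (hG.1 x).2.2.2 c hc _ (hx hxQ)
  · rw [setAverage_eq, setAverage_eq, integral_smul, smul_comm]

theorem avgSet_glue {d : ℕ} {G : (Fin d → ℝ) → Set (EuclideanSpace 𝕜 (Fin n))}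
    (hG : GoodSetValued 𝕜 G) (Q : Set (Fin d → ℝ)) (T : Finset (Set (Fin d → ℝ)))
    (hm : ∀ A ∈ T, MeasurableSet A) (hpos : ∀ A ∈ T, 0 < volume.real A)
    (hsub : ∀ A ∈ T, A ⊆ Q) (hdisj : ∀ A ∈ T, ∀ B ∈ T, A ≠ B → Disjoint A B)
    (v : Set (Fin d → ℝ) → EuclideanSpace 𝕜 (Fin n)) (hv : ∀ A ∈ T, v A ∈ avgSet d G A) :
    ∑ A ∈ T, ((volume.real Q)⁻¹ * volume.real A) • v A ∈ avgSet d G Q := by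
  classical
  have hv' : ∀ A : T, ∃ g : (Fin d → ℝ) → EuclideanSpace 𝕜 (Fin n), Measurable g ∧
    (∀ᵐ x, x ∈ A.1 → g x ∈ G x) ∧ IntegrableOn g A.1 volume ∧ v A.1 = ⨍ x in A.1, g x :=
    fun A => hv A.1 A.2
  choose g hg hsel hint hav using hv'
  have hind : ∀ A : T, Integrable (A.1.indicator (g A)) volume := fun A =>
    (hint A).integrable_indicator (hm A.1 A.2)
  refine ⟨fun x => ∑ A : T, A.1.indicator (g A) x, ?_, ?_, ?_, ?_⟩
  · exact Finset.measurable_sum _ fun A _ => (hg A).indicator (hm A.1 A.2)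
  · filter_upwards [ae_all_iff.2 hsel] with x hx hxQ
    by_cases h : ∃ A : T, x ∈ A.1
    · obtain ⟨A, hA⟩ := h
      rw [Finset.sum_eq_single A]
      · rw [Set.indicator_of_mem hA]; exact hx A hA
      · intro B _ hBA
        apply Set.indicator_of_notMem
        intro hB
        exact Set.disjoint_left.1 (hdisj B.1 B.2 A.1 A.2 (fun h => hBA (Subtype.ext h))) hB hA
      · simp
    · push Not at h
      rw [Finset.sum_eq_zero fun A _ => Set.indicator_of_notMem (h A) _]
      exact zero_mem_of_symm (hG.1 x).1 (hG.1 x).2.2.1 (hG.1 x).2.2.2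
  · exact (integrable_finsetSum _ fun A _ => hind A).integrableOn
  · rw [setAverage_eq, integral_finsetSum _ fun A _ => (hind A).integrableOn, Finset.smul_sum,
      ← Finset.sum_coe_sort]
    refine Finset.sum_congr rfl fun A _ => ?_
    rw [setIntegral_indicator (hm A.1 A.2), Set.inter_eq_self_of_subset_right (hsub A.1 A.2),
      hav A, setAverage_eq, mul_smul, smul_inv_smul₀ (hpos A.1 A.2).ne']

theorem avgSet_bounded {d : ℕ} {G : (Fin d → ℝ) → Set (EuclideanSpace 𝕜 (Fin n))}
    {Q : Set (Fin d → ℝ)} (hQ : MeasurableSet Q)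
    (hfin : ∫⁻ x in Q, (⨆ v ∈ G x, (‖v‖₊ : ℝ≥0∞)) ∂volume ≠ ⊤) :
    Bornology.IsBounded (avgSet d G Q) := by
  rw [isBounded_iff_forall_norm_le]
  refine ⟨(volume.real Q)⁻¹ * (∫⁻ x in Q, (⨆ v ∈ G x, (‖v‖₊ : ℝ≥0∞)) ∂volume).toReal, ?_⟩
  rintro _ ⟨g, hg, hsel, hint, rfl⟩
  rw [setAverage_eq, norm_smul, norm_inv, Real.norm_of_nonneg measureReal_nonneg]
  refine mul_le_mul_of_nonneg_left ?_ (by positivity)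
  rw [← toReal_enorm]
  refine ENNReal.toReal_mono hfin ((enorm_integral_le_lintegral_enorm _).trans ?_)
  apply lintegral_mono_ae
  rw [ae_restrict_iff' hQ]
  filter_upwards [hsel] with x hx hxQ
  exact le_iSup₂ (f := fun v (_ : v ∈ G x) => (‖v‖₊ : ℝ≥0∞)) (g x) (hx hxQ)

/-- Measure bound for the stopping cubes associated with a single functional. -/
theorem stopping_measure {d : ℕ} {α : Fin d → ℝ}
    {G : (Fin d → ℝ) → Set (EuclideanSpace 𝕜 (Fin n))} (hG : GoodSetValued 𝕜 G)
    {Q : Set (Fin d → ℝ)} (hQ : Q ∈ dyadicGrid d α) (T : Set (Set (Fin d → ℝ)))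
    (hT : T.Finite) (hTD : T ⊆ dyadicGrid d α) (hTQ : ∀ A ∈ T, A ⊆ Q)
    (f : EuclideanSpace 𝕜 (Fin n) →ₗ[𝕜] 𝕜) (hf : ∀ w ∈ avgSet d G Q, ‖f w‖ ≤ 1)
    (c : ℝ) (hc : 0 < c) (hbad : ∀ A ∈ T, ∃ v ∈ avgSet d G A, c < ‖f v‖) :
    c * volume.real (⋃ A ∈ T, A) ≤ volume.real Q := by
  classical
  obtain ⟨-, -, hQpos, -⟩ := grid_facts hQ
  let M : Set (Set (Fin d → ℝ)) := {A | Maximal (· ∈ T) A}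
  have hMT : M ⊆ T := fun A hA => hA.prop
  have hMfin : M.Finite := hT.subset hMT
  have hU : (⋃ A ∈ T, A) = ⋃ A ∈ hMfin.toFinset, A := by
    apply Set.Subset.antisymm
    · refine Set.iUnion₂_subset fun A hA => ?_
      obtain ⟨B, hAB, hB⟩ := hT.exists_le_maximal hA
      exact Set.subset_biUnion_of_mem (u := fun A => A)
        (show B ∈ (hMfin.toFinset : Set _) from hMfin.mem_toFinset.2 hB) |>.trans' hAB
    · refine Set.iUnion₂_subset fun A hA => ?_
      exact Set.subset_biUnion_of_mem (u := fun A => A) (hMT (hMfin.mem_toFinset.1 hA))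
  have hmem : ∀ A ∈ hMfin.toFinset, A ∈ M := fun A hA => hMfin.mem_toFinset.1 hA
  have hdisj : ∀ A ∈ hMfin.toFinset, ∀ B ∈ hMfin.toFinset, A ≠ B → Disjoint A B := by
    intro A hA B hB hne
    by_contra h
    have hA' := hmem A hA
    have hB' := hmem B hB
    rcases grid_laminar (hTD (hMT hA')) (hTD (hMT hB')) h with h | h
    · exact hne (hA'.eq_of_le hB'.prop h)
    · exact hne (hB'.eq_of_le hA'.prop h).symm
  have hbad' : ∀ A, ∃ v, A ∈ T → v ∈ avgSet d G A ∧ c ≤ RCLike.re (f v) := by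
    intro A
    by_cases hA : A ∈ T
    · obtain ⟨v, hv, hcv⟩ := hbad A hA
      have hne : f v ≠ 0 := by
        intro h; rw [h, norm_zero] at hcv; linarith
      have hne' : ‖f v‖ ≠ 0 := norm_ne_zero_iff.2 hne
      refine ⟨((‖f v‖ : 𝕜) * (f v)⁻¹) • v, fun _ => ⟨avgSet_symm hG A _ ?_ v hv, ?_⟩⟩
      · rw [norm_mul, norm_inv, RCLike.norm_ofReal, abs_norm, mul_inv_cancel₀ hne']
      · rw [map_smul, smul_eq_mul, mul_assoc, inv_mul_cancel₀ hne, mul_one, RCLike.ofReal_re]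
        exact hcv.le
    · exact ⟨0, fun h => absurd h hA⟩
  choose v hv using hbad'
  have hglue := avgSet_glue hG Q hMfin.toFinset
    (fun A hA => (grid_facts (hTD (hMT (hmem A hA)))).1)
    (fun A hA => (grid_facts (hTD (hMT (hmem A hA)))).2.2.1)
    (fun A hA => hTQ A (hMT (hmem A hA))) hdisj v (fun A hA => (hv A (hMT (hmem A hA))).1)
  have h1 := (RCLike.re_le_norm _).trans (hf _ hglue)
  have h2 : RCLike.re (f (∑ A ∈ hMfin.toFinset, ((volume.real Q)⁻¹ * volume.real A) • v A)) =
      ∑ A ∈ hMfin.toFinset, ((volume.real Q)⁻¹ * volume.real A) * RCLike.re (f (v A)) := by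
    rw [map_sum, map_sum]
    refine Finset.sum_congr rfl fun A _ => ?_
    rw [RCLike.real_smul_eq_coe_smul (K := 𝕜), map_smul, smul_eq_mul, RCLike.re_ofReal_mul]
  have h3 : ∑ A ∈ hMfin.toFinset, ((volume.real Q)⁻¹ * volume.real A) * c ≤
      ∑ A ∈ hMfin.toFinset, ((volume.real Q)⁻¹ * volume.real A) * RCLike.re (f (v A)) := by
    refine Finset.sum_le_sum fun A hA => ?_
    exact mul_le_mul_of_nonneg_left (hv A (hMT (hmem A hA))).2 (by positivity)
  rw [h2] at h1
  have h4 := h3.trans h1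
  rw [← Finset.sum_mul, ← Finset.mul_sum] at h4
  have h5 : volume.real (⋃ A ∈ T, A) ≤ ∑ A ∈ hMfin.toFinset, volume.real A := by
    rw [hU]
    exact measureReal_biUnion_finset_le _ _
  have h6 : (∑ A ∈ hMfin.toFinset, volume.real A) * c ≤ volume.real Q := by
    rw [mul_assoc, inv_mul_le_iff₀ hQpos, mul_one] at h4
    exact h4
  nlinarith

/-- `convK` facts. -/
theorem convK_isClosed (S : Set (EuclideanSpace 𝕜 (Fin n))) : IsClosed (convK 𝕜 S) :=
  isClosed_sInter fun _ h => h.1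

theorem convK_convex (S : Set (EuclideanSpace 𝕜 (Fin n))) : Convex ℝ (convK 𝕜 S) :=
  convex_sInter fun _ h => h.2.1

theorem convK_symm (S : Set (EuclideanSpace 𝕜 (Fin n))) : SymmSet 𝕜 (convK 𝕜 S) :=
  fun c hc x hx K hK => hK.2.2.1 c hc x (hx K hK)

theorem subset_convK (S : Set (EuclideanSpace 𝕜 (Fin n))) : S ⊆ convK 𝕜 S :=
  fun _ hx _ hK => hK.2.2.2 hx

theorem balanced_of_symm {K : Set (EuclideanSpace 𝕜 (Fin n))} (h1 : K.Nonempty)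
    (h2 : Convex ℝ K) (h3 : SymmSet 𝕜 K) (a : 𝕜) (ha : ‖a‖ ≤ 1)
    {x : EuclideanSpace 𝕜 (Fin n)} (hx : x ∈ K) : a • x ∈ K := by
  have h0 := zero_mem_of_symm h1 h2 h3
  by_cases h : a = 0
  · subst h; simpa using h0
  have hne : ‖a‖ ≠ 0 := norm_ne_zero_iff.2 h
  have hu : ((‖a‖ : 𝕜)⁻¹ * a) • x ∈ K := by
    apply h3 _ _ _ hx
    rw [norm_mul, norm_inv, RCLike.norm_ofReal, abs_norm, inv_mul_cancel₀ hne]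
  have := h2.smul_mem_of_zero_mem h0 hu ⟨norm_nonneg a, ha⟩
  rw [RCLike.real_smul_eq_coe_smul (K := 𝕜), smul_smul, ← mul_assoc, mul_inv_cancel₀, one_mul]
    at this
  · exact this
  · exact_mod_cast hne

theorem sum_mem_smul {K : Set (EuclideanSpace 𝕜 (Fin n))} (h1 : K.Nonempty)
    (h2 : Convex ℝ K) (h3 : SymmSet 𝕜 K) {m : ℕ} (a : Fin m → 𝕜) (C : ℝ) (hC : 0 < C)
    (ha : ∀ i, m * ‖a i‖ ≤ C) (v : Fin m → EuclideanSpace 𝕜 (Fin n)) (hv : ∀ i, v i ∈ K) :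
    ∑ i, a i • v i ∈ C • K := by
  rcases Nat.eq_zero_or_pos m with rfl | hm
  · exact ⟨0, zero_mem_of_symm h1 h2 h3, by simp⟩
  have hm' : (0 : ℝ) < m := by exact_mod_cast hm
  have hm0 : (m : 𝕜) ≠ 0 := by exact_mod_cast hm.ne'
  have hC0 : (C : 𝕜) ≠ 0 := by exact_mod_cast hC.ne'
  have hk : ∀ i, ((C : 𝕜)⁻¹ * m * a i) • v i ∈ K := by
    intro i
    apply balanced_of_symm h1 h2 h3 _ _ (hv i)
    rw [norm_mul, norm_mul, norm_inv, RCLike.norm_ofReal, abs_of_pos hC, RCLike.norm_natCast,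
      mul_assoc, inv_mul_le_iff₀ hC, mul_one]
    exact ha i
  have := h2.sum_mem (t := Finset.univ) (w := fun _ : Fin m => (m : ℝ)⁻¹)
    (fun i _ => by positivity) (by simp [hm'.ne']) (fun i _ => hk i)
  refine ⟨_, this, ?_⟩
  simp only [Finset.smul_sum]
  refine Finset.sum_congr rfl fun i _ => ?_
  rw [RCLike.real_smul_eq_coe_smul (K := 𝕜), RCLike.real_smul_eq_coe_smul (K := 𝕜), smul_smul,
    smul_smul]
  congr 1
  push_cast
  field_simp

/-- **sparse domination of the set-valued maximal operator.** Let `D` be a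
(translated) dyadic grid in `ℝᵈ` and `F ⊆ D` finite.  For every locally integrably bounded
convex-set valued mapping `G : ℝᵈ → 𝒦`, there is a sparse subcollection `S ⊆ F` such that
`M^𝒦_F G(x) ⊆ 2 n^{5/2} · M^𝒦_S G(x)` for a.e. `x`. -/
theorem stmt17 (d : ℕ) (α : Fin d → ℝ) (F : Set (Set (Fin d → ℝ)))
    (hFD : F ⊆ dyadicGrid d α) (hfin : F.Finite)
    (G : (Fin d → ℝ) → Set (EuclideanSpace 𝕜 (Fin n)))
    (hG : GoodSetValued 𝕜 G)
    (hloc : ∀ Q : Set (Fin d → ℝ), IsCube d Q →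
      ∫⁻ x in Q, (⨆ v ∈ G x, (‖v‖₊ : ℝ≥0∞)) ∂volume ≠ ⊤) :
    ∃ S ⊆ F, IsSparse d S ∧
      ∀ᵐ x, maximalK d F G x ⊆
        ((2 * (n : ℝ) ^ ((5 : ℝ) / 2)) • maximalK d S G x) := by
  classical
  rcases Nat.eq_zero_or_pos n with rfl | hn
  · refine ⟨∅, Set.empty_subset _, fun Q hQ => absurd hQ (Set.notMem_empty Q), ?_⟩
    refine Filter.Eventually.of_forall fun x y _ => ?_
    exact ⟨0, subset_convK _ (Or.inl rfl), Subsingleton.elim _ _⟩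
  have hn1 : (1 : ℝ) ≤ n := by exact_mod_cast hn
  set C : ℝ := 2 * (n : ℝ) ^ ((5 : ℝ) / 2) with hCdef
  have hC : 0 < C := by positivity
  have hCn : (n : ℝ) * (2 * n) ≤ C := by
    have h : (n : ℝ) ^ (2 : ℝ) ≤ (n : ℝ) ^ ((5 : ℝ) / 2) :=
      Real.rpow_le_rpow_of_exponent_le hn1 (by norm_num)
    rw [Real.rpow_two] at h
    rw [hCdef]
    nlinarith
  have hA : ∀ Q : Set (Fin d → ℝ), ∃ (m : ℕ) (v : Fin m → EuclideanSpace 𝕜 (Fin n))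
      (f : Fin m → EuclideanSpace 𝕜 (Fin n) →ₗ[𝕜] 𝕜), Q ∈ F → m ≤ n ∧
      (∀ i, v i ∈ closure (avgSet d G Q)) ∧
      (∀ i, ∀ w ∈ closure (avgSet d G Q), ‖f i w‖ ≤ 1) ∧
      ∀ w ∈ Submodule.span 𝕜 (closure (avgSet d G Q)), w = ∑ i, f i w • v i := by
    intro Q
    by_cases hQ : Q ∈ F
    · obtain ⟨hm, -, -, Q', hQ', hQQ'⟩ := grid_facts (hFD hQ)
      have hb : Bornology.IsBounded (avgSet d G Q) := avgSet_bounded hm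
        (ne_top_of_le_ne_top (hloc Q' hQ') (lintegral_mono_set hQQ'))
      obtain ⟨m, v, f, h1, h2⟩ := auerbach_exists (𝕜 := 𝕜) _ hb.isCompact_closure
      rw [finrank_euclideanSpace_fin] at h1
      exact ⟨m, v, f, fun _ => ⟨h1, h2⟩⟩
    · exact ⟨0, 0, 0, fun h => absurd h hQ⟩
  choose m v f hmvf using hA
  let bad : Set (Fin d → ℝ) → Set (Fin d → ℝ) → Prop := fun Q' Q =>
    ∃ i : Fin (m Q), ∃ w ∈ avgSet d G Q', 2 * (n : ℝ) < ‖f Q i w‖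
  obtain ⟨S, hSF, hdom, hbad⟩ := greedy_select bad hfin.toFinset
  have hSF' : ∀ Q ∈ S, Q ∈ F := fun Q hQ => hfin.mem_toFinset.1 (hSF hQ)
  refine ⟨(S : Set (Set (Fin d → ℝ))), fun Q hQ => hSF' Q hQ, ?_, ?_⟩
  · intro Q hQ
    have hQF := hSF' Q hQ
    obtain ⟨hmn, -, hf1, -⟩ := hmvf Q hQF
    obtain ⟨-, hQtop, hQpos, -⟩ := grid_facts (hFD hQF)
    let T : Fin (m Q) → Set (Set (Fin d → ℝ)) := fun i =>
      {Q' | Q' ∈ S ∧ Q' ⊂ Q ∧ ∃ w ∈ avgSet d G Q', 2 * (n : ℝ) < ‖f Q i w‖}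
    have hT : ∀ i, 2 * (n : ℝ) * volume.real (⋃ A ∈ T i, A) ≤ volume.real Q := fun i =>
      stopping_measure hG (hFD hQF) (T i) (S.finite_toSet.subset fun A hA => hA.1)
        (fun A hA => hFD (hSF' A hA.1)) (fun A hA => hA.2.1.subset) (f Q i)
        (fun w hw => hf1 i w (subset_closure hw)) (2 * n) (by positivity) (fun A hA => hA.2.2)
    set U : Set (Fin d → ℝ) := ⋃ Q' ∈ {Q' ∈ (S : Set (Set (Fin d → ℝ))) | Q' ⊂ Q}, Q' with hU
    have hUQ : U ⊆ Q := Set.iUnion₂_subset fun A hA => hA.2.subset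
    have hUT : U ⊆ ⋃ i ∈ (Finset.univ : Finset (Fin (m Q))), ⋃ A ∈ T i, A := by
      refine Set.iUnion₂_subset fun A hA => ?_
      obtain ⟨i, hi⟩ := hbad Q hQ A hA.1 hA.2
      intro x hx
      simp only [Set.mem_iUnion]
      exact ⟨i, Finset.mem_univ i, A, ⟨hA.1, hA.2, hi⟩, hx⟩
    have hTQ : (⋃ i ∈ (Finset.univ : Finset (Fin (m Q))), ⋃ A ∈ T i, A) ⊆ Q :=
      Set.iUnion₂_subset fun i _ => Set.iUnion₂_subset fun A hA => hA.2.1.subset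
    have h1 : volume.real U ≤ ∑ i : Fin (m Q), volume.real (⋃ A ∈ T i, A) :=
      (measureReal_mono hUT (ne_top_of_le_ne_top hQtop (measure_mono hTQ))).trans
        (measureReal_biUnion_finset_le _ _)
    have h2 : ∑ i : Fin (m Q), volume.real (⋃ A ∈ T i, A) ≤
        ∑ i : Fin (m Q), volume.real Q / (2 * n) := by
      refine Finset.sum_le_sum fun i _ => ?_
      rw [le_div_iff₀ (by positivity), mul_comm]
      exact hT i
    have h3 : volume.real U ≤ volume.real Q / 2 := by
      refine (h1.trans h2).trans ?_
      rw [Finset.sum_const, Finset.card_univ, Fintype.card_fin, nsmul_eq_mul]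
      have hmn' : (m Q : ℝ) ≤ n := by exact_mod_cast hmn
      calc (m Q : ℝ) * (volume.real Q / (2 * n)) ≤ n * (volume.real Q / (2 * n)) := by gcongr
        _ = volume.real Q / 2 := by field_simp
    have hUtop : volume U ≠ ⊤ := ne_top_of_le_ne_top hQtop (measure_mono hUQ)
    rw [← ENNReal.toReal_le_toReal hUtop (ENNReal.div_ne_top hQtop (by norm_num)),
      ENNReal.toReal_div]
    exact h3
  · refine Filter.Eventually.of_forall fun x => ?_
    set M := maximalK d (S : Set _) G x with hM
    have hMcl : IsClosed M := convK_isClosed _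
    have hMcv : Convex ℝ M := convK_convex _
    have hMsy : SymmSet 𝕜 M := convK_symm _
    have hM0 : (0 : EuclideanSpace 𝕜 (Fin n)) ∈ M := subset_convK _ (Or.inl rfl)
    have hMavg : ∀ R ∈ S, x ∈ R → avgSet d G R ⊆ M := by
      intro R hR hx w hw
      refine subset_convK _ (Or.inr ?_)
      simp only [Set.mem_iUnion]
      exact ⟨R, ⟨hR, hx⟩, hw⟩
    refine Set.sInter_subset_of_mem ⟨?_, hMcv.smul C, ?_, ?_⟩
    · exact hMcl.smul_of_ne_zero hC.ne'
    · rintro c hc _ ⟨y, hy, rfl⟩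
      exact ⟨c • y, hMsy c hc y hy, smul_comm _ _ _⟩
    · refine Set.union_subset ?_ (Set.iUnion₂_subset fun Q hQ => ?_)
      · rintro _ rfl
        exact ⟨0, hM0, smul_zero _⟩
      · obtain ⟨hQF, hxQ⟩ := hQ
        have key : ∀ R ∈ S, Q ⊆ R → ¬ bad Q R → avgSet d G Q ⊆ C • M := by
          intro R hR hQR hnb w hw
          obtain ⟨hmn, hv, -, hspan⟩ := hmvf R (hSF' R hR)
          have hRpos := (grid_facts (hFD (hSF' R hR))).2.2.1
          obtain ⟨hQm, -, hQpos, -⟩ := grid_facts (hFD hQF)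
          have hws : w ∈ Submodule.span 𝕜 (closure (avgSet d G R)) := by
            have hg := avgSet_glue hG R {Q} (by simpa using hQm) (by simpa using hQpos)
              (by simpa using hQR) (by simp) (fun _ => w) (by simpa using hw)
            rw [Finset.sum_singleton] at hg
            have ht : (volume.real R)⁻¹ * volume.real Q ≠ 0 := by positivity
            have hg' := Submodule.subset_span (R := 𝕜) (subset_closure hg)
            rw [RCLike.real_smul_eq_coe_smul (K := 𝕜)] at hg'
            exact (Submodule.smul_mem_iff _ (by exact_mod_cast ht)).1 hg'
          rw [hspan w hws]
          refine sum_mem_smul ⟨0, hM0⟩ hMcv hMsy _ C hC (fun i => ?_) _ (fun i => ?_)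
          · have h1 : ‖f R i w‖ ≤ 2 * n := by
              by_contra h
              exact hnb ⟨i, w, hw, not_le.1 h⟩
            refine le_trans ?_ hCn
            have hmn' : (m R : ℝ) ≤ n := by exact_mod_cast hmn
            gcongr
          · exact closure_minimal (hMavg R hR (hQR hxQ)) hMcl (hv i)
        by_cases hQS : Q ∈ S
        · intro w hw
          have hC1 : 1 ≤ C := by nlinarith
          refine ⟨C⁻¹ • w, ?_, smul_inv_smul₀ hC.ne' w⟩
          exact hMcv.smul_mem_of_zero_mem hM0 (hMavg Q hQS hxQ hw)
            ⟨by positivity, inv_le_one_of_one_le₀ hC1⟩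
        · obtain ⟨R, hR, hlt, hnb⟩ := hdom Q (hfin.mem_toFinset.2 hQF) hQS
          exact key R hR (le_of_lt hlt) hnb
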